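/- arXiv:0804.0845 — 4 statements merged into one kernel-verified Lean document; each statement's English description precedes it below -/
import Mathlib

section
/- Let f : ℝ → ℝ be a concave function with f(0) ≥ 0, let A be a Hermitian n×n complex matrix, and let Z be a contractive n×n complex matrix (i.e. Z*Z ≤ I). Then Tr f(Z*AZ) ≥ Tr Z*f(A)Z. -/
open Matrix ComplexOrder

/-- `f(A)` for a Hermitian matrix `A`: apply `f` to the eigenvalues in a spectral
decomposition of `A`. -/
noncomputable def matFn {n : ℕ} (f : ℝ → ℝ) (A : Matrix (Fin n) (Fin n) ℂ)
    (hA : A.IsHermitian) : Matrix (Fin n) (Fin n) ℂ :=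
  (hA.eigenvectorUnitary : Matrix (Fin n) (Fin n) ℂ) *
    Matrix.diagonal (fun i => (f (hA.eigenvalues i) : ℂ)) *
    (star hA.eigenvectorUnitary : Matrix (Fin n) (Fin n) ℂ)

theorem matFn_isHermitian {n : ℕ} (f : ℝ → ℝ) (A : Matrix (Fin n) (Fin n) ℂ)
    (hA : A.IsHermitian) : (matFn f A hA).IsHermitian := by
  have h1 : (Matrix.diagonal (fun i => (f (hA.eigenvalues i) : ℂ))).IsHermitian :=
    Matrix.isHermitian_diagonal_of_self_adjoint _ (by ext i; simp [Pi.star_def])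
  have h2 := Matrix.isHermitian_mul_mul_conjTranspose
    (hA.eigenvectorUnitary : Matrix (Fin n) (Fin n) ℂ) h1
  simpa [matFn, Matrix.star_eq_conjTranspose] using h2

/-- The sum of the `k` largest entries of `μ` (for the eigenvalue vector of a Hermitian
matrix, this is the Ky Fan `k`-sum of its eigenvalues). -/
noncomputable def sumKLargest {n : ℕ} (μ : Fin n → ℝ) (k : ℕ) : ℝ :=
  (((List.ofFn μ).insertionSort (· ≥ ·)).take k).sum

theorem isHermitian_sum_conj {n m : ℕ} (A Z : Fin m → Matrix (Fin n) (Fin n) ℂ)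
    (hA : ∀ i, (A i).IsHermitian) : (∑ i, (Z i)ᴴ * A i * Z i).IsHermitian := by
  rw [Matrix.IsHermitian, Matrix.conjTranspose_sum]
  exact Finset.sum_congr rfl fun i _ =>
    Matrix.isHermitian_conjTranspose_mul_mul (Z i) (hA i)

/-- The Jensen inequality for a concave function that is nonnegative at `0`, with weights of total
mass at most one. -/
theorem ConcaveOn.sum_mul_le_map_sum_of_sum_le_one {ι : Type*} [Fintype ι] {f : ℝ → ℝ}
    (hf : ConcaveOn ℝ Set.univ f) (hf0 : 0 ≤ f 0) {w a : ι → ℝ} (hw : ∀ i, 0 ≤ w i)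
    (hw1 : ∑ i, w i ≤ 1) : ∑ i, f (a i) * w i ≤ f (∑ i, a i * w i) := by
  have h := hf.le_map_sum (t := Finset.univ)
    (w := fun o : Option ι => o.elim (1 - ∑ i, w i) w) (p := fun o => o.elim 0 a)
    (by rintro (_ | i) - <;> simp [hw, hw1]) (by simp [Fintype.sum_option]) (by simp)
  simp only [Fintype.sum_option, Option.elim_none, Option.elim_some, smul_eq_mul, mul_zero,
    zero_add] at h
  simp only [mul_comm _ (w _)]
  linarith [mul_nonneg (sub_nonneg.2 hw1) hf0]

theorem Matrix.conjTranspose_mul_diagonal_mul_apply_self {m n : Type*} [Fintype m] [DecidableEq m]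
    (W : Matrix m n ℂ) (c : m → ℝ) (j : n) :
    (Wᴴ * Matrix.diagonal (fun i => (c i : ℂ)) * W) j j =
      ((∑ i, c i * Complex.normSq (W i j) : ℝ) : ℂ) := by
  rw [Matrix.mul_apply, Complex.ofReal_sum]
  refine Finset.sum_congr rfl fun i _ => ?_
  rw [Matrix.mul_diagonal, Matrix.conjTranspose_apply, Complex.ofReal_mul,
    Complex.normSq_eq_conj_mul_self, Complex.star_def]
  ring

theorem trace_matFn {n : ℕ} (f : ℝ → ℝ) (A : Matrix (Fin n) (Fin n) ℂ) (hA : A.IsHermitian) :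
    (matFn f A hA).trace = ((∑ i, f (hA.eigenvalues i) : ℝ) : ℂ) := by
  rw [matFn, Matrix.trace_mul_comm, ← mul_assoc, Unitary.coe_star_mul_self,
    one_mul, Matrix.trace_diagonal, Complex.ofReal_sum]

theorem matFn_id {n : ℕ} (A : Matrix (Fin n) (Fin n) ℂ) (hA : A.IsHermitian) :
    matFn id A hA = A :=
  hA.spectral_theorem.symm

/-- Brown–Kosaki type trace inequality for Hermitian matrices: for a concave function
`f : ℝ → ℝ` with `f(0) ≥ 0`, a Hermitian `A` and a contractive `Z` (`Z*Z ≤ I`),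
`Tr f(Z* A Z) ≥ Tr Z* f(A) Z`. -/
theorem trace_concave_contractive_hermitian {n : ℕ} (f : ℝ → ℝ)
    (hf : ConcaveOn ℝ Set.univ f) (hf0 : 0 ≤ f 0)
    (A Z : Matrix (Fin n) (Fin n) ℂ) (hA : A.IsHermitian)
    (hZ : ((1 : Matrix (Fin n) (Fin n) ℂ) - Zᴴ * Z).PosSemidef) :
    (Zᴴ * matFn f A hA * Z).trace ≤
    (matFn f _ (Matrix.isHermitian_conjTranspose_mul_mul Z hA)).trace := by
  have hB := Matrix.isHermitian_conjTranspose_mul_mul Z hA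
  set V : Matrix (Fin n) (Fin n) ℂ := ↑hB.eigenvectorUnitary
  set U : Matrix (Fin n) (Fin n) ℂ := ↑hA.eigenvectorUnitary with hU
  have hVV : Vᴴ * V = 1 := Unitary.coe_star_mul_self hB.eigenvectorUnitary
  have hVV' : V * Vᴴ = 1 := Unitary.coe_mul_star_self hB.eigenvectorUnitary
  have hUU' : U * Uᴴ = 1 := Unitary.coe_mul_star_self hA.eigenvectorUnitary
  set W := Uᴴ * Z * V with hW
  have hWg (g : ℝ → ℝ) : Vᴴ * (Zᴴ * matFn g A hA * Z) * V =
      Wᴴ * Matrix.diagonal (fun i => (g (hA.eigenvalues i) : ℂ)) * W := by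
    simp only [matFn, hW, Matrix.conjTranspose_mul, Matrix.conjTranspose_conjTranspose,
      Matrix.star_eq_conjTranspose, mul_assoc, ← hU]
  have heig (j : Fin n) : hB.eigenvalues j =
      ∑ i, hA.eigenvalues i * Complex.normSq (W i j) := by
    have h1 : Vᴴ * (Zᴴ * A * Z) * V =
        Matrix.diagonal (fun i => (hB.eigenvalues i : ℂ)) := by
      have h2 : Zᴴ * A * Z =
          V * Matrix.diagonal (fun i => (hB.eigenvalues i : ℂ)) * Vᴴ := (matFn_id _ hB).symm
      refine (congrArg (fun M => Vᴴ * M * V) h2).trans ?_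
      rw [mul_assoc Vᴴ, mul_assoc (V * _), hVV, mul_one, ← mul_assoc, hVV, one_mul]
    have h2 := hWg id
    rw [matFn_id, h1] at h2
    have h3 := congrFun (congrFun h2 j) j
    rw [Matrix.diagonal_apply_eq, Matrix.conjTranspose_mul_diagonal_mul_apply_self] at h3
    exact_mod_cast h3
  have hcol (j : Fin n) : ∑ i, Complex.normSq (W i j) ≤ 1 := by
    have h1 : Vᴴ * (1 - Zᴴ * Z) * V = 1 - Wᴴ * Matrix.diagonal (fun _ => ((1 : ℝ) : ℂ)) * W := by
      have h2 : Wᴴ * W = Vᴴ * (Zᴴ * Z) * V := by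
        calc Wᴴ * W = Vᴴ * Zᴴ * (U * Uᴴ) * Z * V := by
              simp only [hW, Matrix.conjTranspose_mul, Matrix.conjTranspose_conjTranspose,
                mul_assoc]
          _ = _ := by rw [hUU']; simp only [mul_one, mul_assoc]
      simp only [Complex.ofReal_one, Matrix.diagonal_one, mul_one, h2, mul_sub, sub_mul, hVV]
    have h3 := (hZ.conjTranspose_mul_mul_same V).diag_nonneg (i := j)
    rw [h1, Matrix.sub_apply, Matrix.one_apply_eq,
      Matrix.conjTranspose_mul_diagonal_mul_apply_self, sub_nonneg] at h3
    simp only [one_mul] at h3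
    exact_mod_cast h3
  have htr : (Zᴴ * matFn f A hA * Z).trace =
      ((∑ j, ∑ i, f (hA.eigenvalues i) * Complex.normSq (W i j) : ℝ) : ℂ) := by
    have h1 : (Zᴴ * matFn f A hA * Z).trace = (Vᴴ * (Zᴴ * matFn f A hA * Z) * V).trace := by
      rw [Matrix.trace_mul_comm (Vᴴ * _), ← mul_assoc, hVV', one_mul]
    rw [h1, hWg, Matrix.trace, Complex.ofReal_sum]
    exact Finset.sum_congr rfl fun j _ =>
      Matrix.conjTranspose_mul_diagonal_mul_apply_self W (fun i => f (hA.eigenvalues i)) j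
  rw [htr, trace_matFn, Complex.real_le_real]
  refine Finset.sum_le_sum fun j _ => ?_
  rw [heig j]
  exact hf.sum_mul_le_map_sum_of_sum_le_one hf0 (fun i => Complex.normSq_nonneg _) (hcol j)
end

section
/- (Rotfel'd trace inequality) Let A and B be positive semidefinite n×n complex matrices and let f : [0,∞) → [0,∞) be a concave function. Then Tr f(A+B) ≤ Tr f(A) + Tr f(B). -/
open Matrix ComplexOrder

theorem inner_mul_inner_symm_eq_norm_sq {E : Type*} [NormedAddCommGroup E]
    [InnerProductSpace ℂ E] (x y : E) :
    inner ℂ x y * inner ℂ y x = ((‖inner ℂ x y‖ ^ 2 : ℝ) : ℂ) := by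
  rw [← inner_conj_symm y x, Complex.mul_conj, Complex.normSq_eq_norm_sq]

/-- The quadratic form of a Hermitian matrix in coordinates of its eigenvector basis. -/
theorem re_inner_toEuclideanLin_self {n : ℕ} (A : Matrix (Fin n) (Fin n) ℂ) (hA : A.IsHermitian)
    (x : EuclideanSpace ℂ (Fin n)) :
    (inner ℂ x (Matrix.toEuclideanLin A x)).re =
      ∑ i, hA.eigenvalues i * ‖inner ℂ (hA.eigenvectorBasis i) x‖ ^ 2 := by
  have key : ∀ i, inner ℂ (hA.eigenvectorBasis i) (Matrix.toEuclideanLin A x) =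
      (hA.eigenvalues i : ℂ) * inner ℂ (hA.eigenvectorBasis i) x := by
    intro i
    have hs := (Matrix.isSymmetric_toEuclideanLin_iff.mpr hA) (hA.eigenvectorBasis i) x
    have he : Matrix.toEuclideanLin A (hA.eigenvectorBasis i) =
        (hA.eigenvalues i : ℂ) • hA.eigenvectorBasis i := by
      have := hA.mulVec_eigenvectorBasis i
      ext j
      simpa using congrFun this j
    rw [← hs, he, inner_smul_left]
    simp
  rw [← hA.eigenvectorBasis.sum_inner_mul_inner x, Complex.re_sum]
  refine Finset.sum_congr rfl fun i _ => ?_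
  rw [key, mul_left_comm, inner_mul_inner_symm_eq_norm_sq, norm_inner_symm, ← Complex.ofReal_mul,
    Complex.ofReal_re]

section OrthonormalBasis

variable {ι E : Type*} [Fintype ι] [NormedAddCommGroup E] [InnerProductSpace ℂ E]

/-- If `∑ aᵢ |uᵢ⟩⟨uᵢ| ≤ ∑ sₖ |wₖ⟩⟨wₖ|`, then
`aᵢ ⟨uᵢ, S⁺ uᵢ⟩ ≤ 1`, where `S⁺` is the pseudo-inverse of the right-hand side. -/
theorem sum_div_mul_norm_inner_sq_le_one (u w : OrthonormalBasis ι ℂ E) {a s : ι → ℝ}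
    (ha : ∀ i, 0 ≤ a i) (hs : ∀ i, 0 ≤ s i)
    (h : ∀ x, ∑ i, a i * ‖inner ℂ (u i) x‖ ^ 2 ≤ ∑ k, s k * ‖inner ℂ (w k) x‖ ^ 2) (i : ι) :
    ∑ k, a i / s k * ‖inner ℂ (u i) (w k)‖ ^ 2 ≤ 1 := by
  set t : ℝ := ∑ k, (s k)⁻¹ * ‖inner ℂ (u i) (w k)‖ ^ 2 with ht
  have ht0 : 0 ≤ t := Finset.sum_nonneg fun k _ =>
    mul_nonneg (inv_nonneg.mpr (hs k)) (sq_nonneg _)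
  let v : E := ∑ k, (((s k)⁻¹ : ℝ) * inner ℂ (w k) (u i) : ℂ) • w k
  have hw : ∀ k, inner ℂ (w k) v = (((s k)⁻¹ : ℝ) : ℂ) * inner ℂ (w k) (u i) := fun k =>
    w.orthonormal.inner_right_fintype _ k
  have hu : inner ℂ (u i) v = (t : ℂ) := by
    rw [← w.sum_inner_mul_inner, ht, Complex.ofReal_sum]
    refine Finset.sum_congr rfl fun k _ => ?_
    rw [hw, mul_left_comm, inner_mul_inner_symm_eq_norm_sq, ← Complex.ofReal_mul]
  have hS : ∑ k, s k * ‖inner ℂ (w k) v‖ ^ 2 = t := by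
    refine Finset.sum_congr rfl fun k _ => ?_
    rw [hw, norm_mul, mul_pow, Complex.norm_real, Real.norm_eq_abs, sq_abs,
      norm_inner_symm (w k)]
    rcases eq_or_ne (s k) 0 with h0 | h0
    · simp [h0]
    · field_simp
  have h1 : a i * t ^ 2 ≤ t := by
    calc a i * t ^ 2 = a i * ‖inner ℂ (u i) v‖ ^ 2 := by
          rw [hu, Complex.norm_real, Real.norm_eq_abs, sq_abs]
      _ ≤ ∑ j, a j * ‖inner ℂ (u j) v‖ ^ 2 :=
          Finset.single_le_sum (f := fun j => a j * ‖inner ℂ (u j) v‖ ^ 2)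
            (fun j _ => mul_nonneg (ha j) (sq_nonneg _)) (Finset.mem_univ i)
      _ ≤ t := (h v).trans_eq hS
  have h2 : ∑ k, a i / s k * ‖inner ℂ (u i) (w k)‖ ^ 2 = a i * t := by
    rw [ht, Finset.mul_sum]
    exact Finset.sum_congr rfl fun k _ => by rw [div_eq_mul_inv, mul_assoc]
  rw [h2]
  rcases ht0.eq_or_lt with h0 | h0
  · simp [← h0]
  · exact le_of_mul_le_mul_right (by nlinarith) h0

theorem sum_div_mul_norm_inner_sq_mul (u w : OrthonormalBasis ι ℂ E) {a s : ι → ℝ}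
    (ha : ∀ i, 0 ≤ a i)
    (h : ∀ x, ∑ i, a i * ‖inner ℂ (u i) x‖ ^ 2 ≤ ∑ k, s k * ‖inner ℂ (w k) x‖ ^ 2) (i : ι) :
    ∑ k, a i / s k * ‖inner ℂ (u i) (w k)‖ ^ 2 * s k = a i := by
  have h1 : ∑ k, ‖inner ℂ (u i) (w k)‖ ^ 2 = 1 := by
    rw [w.sum_sq_norm_inner_left, u.orthonormal.1 i, one_pow]
  calc _ = ∑ k, a i * ‖inner ℂ (u i) (w k)‖ ^ 2 := by
        refine Finset.sum_congr rfl fun k _ => ?_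
        rcases eq_or_ne (s k) 0 with h0 | h0
        · have hk := h (w k)
          have hz : ∑ l, s l * ‖inner ℂ (w l) (w k)‖ ^ 2 = 0 :=
            Finset.sum_eq_zero fun l _ => by
              rcases eq_or_ne l k with rfl | hl
              · simp [h0]
              · simp [w.orthonormal.2 hl]
          have := Finset.single_le_sum (f := fun j => a j * ‖inner ℂ (u j) (w k)‖ ^ 2)
            (fun j _ => mul_nonneg (ha j) (sq_nonneg _)) (Finset.mem_univ i)
          have hn := mul_nonneg (ha i) (sq_nonneg ‖inner ℂ (u i) (w k)‖)
          simp only [h0, mul_zero]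
          linarith
        · field_simp
    _ = a i := by rw [← Finset.mul_sum, h1, mul_one]

/-- Jensen's inequality for a concave function with weights of total mass at most one. -/
theorem ConcaveOn.sum_mul_le_map_sum {g : ℝ → ℝ} (hg : ConcaveOn ℝ (Set.Ici 0) g)
    (hg0 : 0 ≤ g 0) {p s : ι → ℝ} (hp : ∀ k, 0 ≤ p k) (hp1 : ∑ k, p k ≤ 1)
    (hs : ∀ k, 0 ≤ s k) : ∑ k, p k * g (s k) ≤ g (∑ k, p k * s k) := by
  have := hg.map_add_sum_le (t := Finset.univ) (w := p) (p := s) (v := 1 - ∑ k, p k) (q := 0)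
    (fun k _ => hp k) (by ring) (fun k _ => hs k) (by linarith) (by simp)
  simp only [smul_eq_mul, mul_zero, zero_add] at this
  nlinarith [mul_nonneg (sub_nonneg.mpr hp1) hg0]

theorem sum_mul_sum_norm_inner_sq_le (u w : OrthonormalBasis ι ℂ E) {a s : ι → ℝ}
    (ha : ∀ i, 0 ≤ a i) (hs : ∀ i, 0 ≤ s i)
    (h : ∀ x, ∑ i, a i * ‖inner ℂ (u i) x‖ ^ 2 ≤ ∑ k, s k * ‖inner ℂ (w k) x‖ ^ 2)
    {g : ℝ → ℝ} (hg : ConcaveOn ℝ (Set.Ici 0) g) (hg0 : 0 ≤ g 0) :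
    ∑ k, g (s k) / s k * ∑ i, a i * ‖inner ℂ (u i) (w k)‖ ^ 2 ≤ ∑ i, g (a i) := by
  simp_rw [Finset.mul_sum]
  rw [Finset.sum_comm]
  refine Finset.sum_le_sum fun i _ => ?_
  have := hg.sum_mul_le_map_sum hg0
    (fun k => mul_nonneg (div_nonneg (ha i) (hs k)) (sq_nonneg ‖inner ℂ (u i) (w k)‖))
    (sum_div_mul_norm_inner_sq_le_one u w ha hs h i) hs
  rw [sum_div_mul_norm_inner_sq_mul u w ha h i] at this
  refine le_of_eq_of_le (Finset.sum_congr rfl fun k _ => ?_) this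
  ring

theorem sum_map_le_of_sum_norm_inner_sq_eq (u v w : OrthonormalBasis ι ℂ E) {a b s : ι → ℝ}
    (ha : ∀ i, 0 ≤ a i) (hb : ∀ i, 0 ≤ b i) (hs : ∀ i, 0 ≤ s i)
    (h : ∀ x, ∑ k, s k * ‖inner ℂ (w k) x‖ ^ 2 =
      ∑ i, a i * ‖inner ℂ (u i) x‖ ^ 2 + ∑ i, b i * ‖inner ℂ (v i) x‖ ^ 2)
    {g : ℝ → ℝ} (hg : ConcaveOn ℝ (Set.Ici 0) g) (hg0 : g 0 = 0) :
    ∑ k, g (s k) ≤ ∑ i, g (a i) + ∑ i, g (b i) := by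
  have hu := sum_mul_sum_norm_inner_sq_le u w ha hs (fun x => by
    rw [h x]
    exact le_add_of_nonneg_right
      (Finset.sum_nonneg fun i _ => mul_nonneg (hb i) (sq_nonneg _))) hg hg0.ge
  have hv := sum_mul_sum_norm_inner_sq_le v w hb hs (fun x => by
    rw [h x]
    exact le_add_of_nonneg_left
      (Finset.sum_nonneg fun i _ => mul_nonneg (ha i) (sq_nonneg _))) hg hg0.ge
  refine le_of_eq_of_le ?_ (add_le_add hu hv)
  rw [← Finset.sum_add_distrib]
  refine Finset.sum_congr rfl fun k _ => ?_
  rw [← mul_add, ← h (w k), Finset.sum_eq_single k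
    (fun l _ hl => by simp [w.orthonormal.2 hl]) (by simp)]
  have hk : ‖inner ℂ (w k) (w k)‖ = 1 := by simp
  rw [hk]
  rcases eq_or_ne (s k) 0 with h0 | h0
  · simp [h0, hg0]
  · simp [h0]

end OrthonormalBasis



/-- Rotfel'd trace inequality: for positive semidefinite `A`, `B` and a non-negative
concave function `f` on `[0,∞)`, `Tr f(A+B) ≤ Tr f(A) + Tr f(B)`. -/
theorem rotfeld_trace {n : ℕ} (A B : Matrix (Fin n) (Fin n) ℂ)
    (hA : A.PosSemidef) (hB : B.PosSemidef)
    (f : ℝ → ℝ) (hf : ConcaveOn ℝ (Set.Ici 0) f)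
    (hf0 : ∀ x ∈ Set.Ici (0 : ℝ), 0 ≤ f x) :
    (matFn f _ (hA.1.add hB.1)).trace ≤
    (matFn f A hA.1).trace + (matFn f B hB.1).trace := by
  have hg : ConcaveOn ℝ (Set.Ici 0) (fun x => f x - f 0) := hf.sub (convexOn_const _ hf.1)
  have key := sum_map_le_of_sum_norm_inner_sq_eq hA.1.eigenvectorBasis hB.1.eigenvectorBasis
    (hA.1.add hB.1).eigenvectorBasis hA.eigenvalues_nonneg hB.eigenvalues_nonneg
    (hA.add hB).eigenvalues_nonneg (fun x => by
      simp_rw [← re_inner_toEuclideanLin_self]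
      rw [map_add, LinearMap.add_apply, inner_add_right, Complex.add_re]) hg (sub_self _)
  have h0 : 0 ≤ ∑ _i : Fin n, f 0 := Finset.sum_nonneg fun _ _ => hf0 0 (by simp)
  rw [trace_matFn, trace_matFn, trace_matFn, ← Complex.ofReal_add, Complex.real_le_real]
  simp only [Finset.sum_sub_distrib] at key
  linarith
end

section
/- Let A and B be positive semidefinite n×n complex matrices and let f : [0,∞) → [0,∞) be a concave function. Then there exist unitary n×n matrices U and V such that f(A+B) ≤ U f(A) U* + V f(B) V* in the Loewner order. -/
open Matrix ComplexOrder

/-- A nonnegative concave function on `[0,∞)` is nondecreasing. -/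
theorem ConcaveOn.monotoneOn_Ici_of_nonneg {f : ℝ → ℝ} (hf : ConcaveOn ℝ (Set.Ici 0) f)
    (hf0 : ∀ x ∈ Set.Ici (0 : ℝ), 0 ≤ f x) : MonotoneOn f (Set.Ici 0) := by
  intro x hx y hy hxy
  by_contra! hlt
  have hne : x < y := lt_of_le_of_ne hxy (by rintro rfl; exact lt_irrefl _ hlt)
  have hd : 0 < f x - f y := sub_pos.2 hlt
  have hyx : 0 < y - x := sub_pos.2 hne
  have hfy := hf0 y hy
  set t := (y - x) * (f y + 1) / (f x - f y) with ht
  have htpos : 0 < t := by positivity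
  have hz : y + t ∈ Set.Ici (0 : ℝ) := by
    simp only [Set.mem_Ici] at hy ⊢
    linarith
  have hs := hf.slope_anti_adjacent hx hz hne (lt_add_of_pos_right y htpos)
  rw [add_sub_cancel_left, div_le_div_iff₀ htpos hyx] at hs
  have h2 : (f y - f x) * t = -((f y + 1) * (y - x)) := by
    rw [ht]
    field_simp
    ring
  rw [h2] at hs
  have := hf0 _ hz
  nlinarith

namespace Matrix

theorem isHermitian_diagonal_ofReal {n : Type*} [DecidableEq n] (d : n → ℝ) :
    (diagonal (fun i => (d i : ℂ))).IsHermitian :=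
  isHermitian_diagonal_of_self_adjoint _ (by ext i; simp)

variable {m n : Type*} [Fintype m] [Fintype n] [DecidableEq n]

theorem re_dotProduct_conj_diagonal_mulVec (P : Matrix m n ℂ) (d : n → ℝ) (h : m → ℂ) :
    (star h ⬝ᵥ ((P * diagonal (fun i => (d i : ℂ)) * Pᴴ) *ᵥ h)).re =
      ∑ j, d j * Complex.normSq ((Pᴴ *ᵥ h) j) := by
  rw [← mulVec_mulVec, ← mulVec_mulVec, dotProduct_mulVec]
  have : star h ᵥ* P = star (Pᴴ *ᵥ h) := by rw [star_mulVec, conjTranspose_conjTranspose]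
  rw [this, dotProduct, Complex.re_sum]
  refine Finset.sum_congr rfl fun j _ => ?_
  rw [mulVec_diagonal, Pi.star_apply, Complex.star_def, mul_left_comm,
    ← Complex.normSq_eq_conj_mul_self, ← Complex.ofReal_mul, Complex.ofReal_re]

theorem re_dotProduct_mul_conjTranspose_mulVec (P : Matrix m n ℂ) (h : m → ℂ) :
    (star h ⬝ᵥ ((P * Pᴴ) *ᵥ h)).re = ∑ j, Complex.normSq ((Pᴴ *ᵥ h) j) := by
  simpa using re_dotProduct_conj_diagonal_mulVec P (fun _ => 1) h

theorem IsHermitian.eq_conj_diagonal {A : Matrix n n ℂ} (hA : A.IsHermitian) :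
    A = (hA.eigenvectorUnitary : Matrix n n ℂ) * diagonal (fun i => (hA.eigenvalues i : ℂ)) *
      (hA.eigenvectorUnitary : Matrix n n ℂ)ᴴ := by
  conv_lhs => rw [hA.spectral_theorem]
  rfl

theorem sum_normSq_conjTranspose_mulVec {U : Matrix n n ℂ} (hU : U ∈ unitaryGroup n ℂ)
    (h : n → ℂ) : ∑ j, Complex.normSq ((Uᴴ *ᵥ h) j) = ∑ j, Complex.normSq (h j) := by
  have hU' : U * Uᴴ = 1 := mem_unitaryGroup_iff.1 hU
  rw [← re_dotProduct_mul_conjTranspose_mulVec, hU']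
  simpa using re_dotProduct_mul_conjTranspose_mulVec (1 : Matrix n n ℂ) h

/-- A form of the Courant–Fischer principle: some unit vector separates the values of the
quadratic forms of `M` and `N` by their eigenvalues of the same index. -/
theorem exists_unit_eigenvalues_le {M N : Matrix n n ℂ} (hM : M.IsHermitian)
    (hN : N.IsHermitian) (i : n) :
    ∃ h : n → ℂ, ∑ j, Complex.normSq (h j) = 1 ∧
      hM.eigenvalues i ≤ (star h ⬝ᵥ (M *ᵥ h)).re ∧
      (star h ⬝ᵥ (N *ᵥ h)).re ≤ hN.eigenvalues i := by
  set e : n ≃ Fin (Fintype.card n) := (Fintype.equivOfCardEq (Fintype.card_fin _)).symm with he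
  set U : Matrix n n ℂ := hM.eigenvectorUnitary.1 with hUdef
  set W : Matrix n n ℂ := hN.eigenvectorUnitary.1 with hWdef
  have hU : U ∈ unitaryGroup n ℂ := hM.eigenvectorUnitary.2
  have hW : W ∈ unitaryGroup n ℂ := hN.eigenvectorUnitary.2
  let K : Matrix {j // j ≠ i} n ℂ := fun j => if e i < e j then Uᴴ j else Wᴴ j
  have hker : LinearMap.ker K.mulVecLin ≠ ⊥ := by
    apply LinearMap.ker_ne_bot_of_finrank_lt
    rw [Module.finrank_fintype_fun_eq_card, Module.finrank_fintype_fun_eq_card]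
    exact Fintype.card_subtype_lt (x := i) (by simp)
  obtain ⟨h, hmem, hne⟩ := Submodule.exists_mem_ne_zero_of_ne_bot hker
  have hK (j : {j // j ≠ i}) : (K *ᵥ h) j = 0 := congrFun (LinearMap.mem_ker.1 hmem) j
  have hKU (j : n) (hj : e i < e j) : (Uᴴ *ᵥ h) j = 0 := by
    have := hK ⟨j, by rintro rfl; exact lt_irrefl _ hj⟩
    simpa only [mulVec, K, if_pos hj] using this
  have hKW (j : n) (hj : e j < e i) : (Wᴴ *ᵥ h) j = 0 := by
    have := hK ⟨j, by rintro rfl; exact lt_irrefl _ hj⟩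
    simpa only [mulVec, K, if_neg hj.not_gt] using this
  have hpos : 0 < ∑ j, Complex.normSq (h j) := by
    obtain ⟨j, hj⟩ := Function.ne_iff.1 hne
    exact Finset.sum_pos' (fun _ _ => Complex.normSq_nonneg _)
      ⟨j, Finset.mem_univ _, Complex.normSq_pos.2 hj⟩
  set s := ∑ j, Complex.normSq (h j) with hs
  have h1 : hM.eigenvalues i * s ≤ (star h ⬝ᵥ (M *ᵥ h)).re := by
    conv_rhs => rw [hM.eq_conj_diagonal, re_dotProduct_conj_diagonal_mulVec]
    rw [hs, ← sum_normSq_conjTranspose_mulVec hU, Finset.mul_sum]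
    refine Finset.sum_le_sum fun j _ => ?_
    rcases lt_or_ge (e i) (e j) with hj | hj
    · simp [hKU j hj, ← hUdef]
    · exact mul_le_mul_of_nonneg_right (hM.eigenvalues₀_antitone hj) (Complex.normSq_nonneg _)
  have h2 : (star h ⬝ᵥ (N *ᵥ h)).re ≤ hN.eigenvalues i * s := by
    conv_lhs => rw [hN.eq_conj_diagonal, re_dotProduct_conj_diagonal_mulVec]
    rw [hs, ← sum_normSq_conjTranspose_mulVec hW, Finset.mul_sum]
    refine Finset.sum_le_sum fun j _ => ?_
    rcases lt_or_ge (e j) (e i) with hj | hj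
    · simp [hKW j hj, ← hWdef]
    · exact mul_le_mul_of_nonneg_right (hN.eigenvalues₀_antitone hj) (Complex.normSq_nonneg _)
  set c : ℝ := (√s)⁻¹ with hc
  have hcs : c * c * s = 1 := by
    rw [hc, ← mul_inv, Real.mul_self_sqrt hpos.le, inv_mul_cancel₀ hpos.ne']
  have hcc : 0 ≤ c * c := mul_self_nonneg c
  have hscale (Q : Matrix n n ℂ) : (star ((c : ℂ) • h) ⬝ᵥ (Q *ᵥ ((c : ℂ) • h))).re =
      c * c * (star h ⬝ᵥ (Q *ᵥ h)).re := by
    rw [mulVec_smul, star_smul, smul_dotProduct, dotProduct_smul, smul_smul, smul_eq_mul,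
      Complex.star_def, Complex.conj_ofReal, ← Complex.ofReal_mul, Complex.re_ofReal_mul]
  refine ⟨(c : ℂ) • h, ?_, ?_, ?_⟩
  · simp only [Pi.smul_apply, smul_eq_mul, Complex.normSq_mul, Complex.normSq_ofReal,
      ← Finset.mul_sum]
    exact hcs
  · rw [hscale]
    calc hM.eigenvalues i = c * c * (hM.eigenvalues i * s) := by
          linear_combination -(hM.eigenvalues i) * hcs
      _ ≤ _ := mul_le_mul_of_nonneg_left h1 hcc
  · rw [hscale]
    calc _ ≤ c * c * (hN.eigenvalues i * s) := mul_le_mul_of_nonneg_left h2 hcc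
      _ = hN.eigenvalues i := by linear_combination hN.eigenvalues i * hcs

/-- Compressing by a contraction `X` and applying a nonnegative concave function: eigenvalue by
eigenvalue, `X f(D) X*` is dominated by `f(X D X*)`. -/
theorem eigenvalues_contraction_le {f : ℝ → ℝ} (hf : ConcaveOn ℝ (Set.Ici 0) f)
    (hf0 : ∀ x ∈ Set.Ici (0 : ℝ), 0 ≤ f x) {d : n → ℝ} (hd : ∀ i, 0 ≤ d i)
    {X : Matrix n n ℂ} (hX : (1 - X * Xᴴ).PosSemidef)
    (hM : (X * diagonal (fun i => (f (d i) : ℂ)) * Xᴴ).IsHermitian)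
    (hN : (X * diagonal (fun i => (d i : ℂ)) * Xᴴ).IsHermitian) (i : n) :
    hM.eigenvalues i ≤ f (hN.eigenvalues i) := by
  obtain ⟨h, h1, h2, h3⟩ := exists_unit_eigenvalues_le hM hN i
  rw [re_dotProduct_conj_diagonal_mulVec X (fun i => f (d i))] at h2
  rw [re_dotProduct_conj_diagonal_mulVec] at h3
  set w : n → ℝ := fun j => Complex.normSq ((Xᴴ *ᵥ h) j) with hw
  have hw0 (j : n) : 0 ≤ w j := Complex.normSq_nonneg _
  have hw1 : ∑ j, w j ≤ 1 := by
    have h4 := (Complex.le_def.1 (hX.dotProduct_mulVec_nonneg h)).1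
    rw [sub_mulVec, dotProduct_sub, Complex.sub_re, re_dotProduct_mul_conjTranspose_mulVec] at h4
    have h5 := re_dotProduct_mul_conjTranspose_mulVec (1 : Matrix n n ℂ) h
    simp only [conjTranspose_one, mul_one, one_mulVec] at h4 h5
    rw [h5, h1, Complex.zero_re] at h4
    exact sub_nonneg.1 h4
  have hJ := hf.map_add_sum_le (t := Finset.univ) (w := w) (p := d) (v := 1 - ∑ j, w j) (q := 0)
    (fun j _ => hw0 j) (by ring) (fun j _ => hd j) (sub_nonneg.2 hw1) (Set.mem_Ici.2 le_rfl)
  simp only [smul_eq_mul, mul_zero, zero_add] at hJ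
  have hsum : 0 ≤ ∑ j, w j * d j := Finset.sum_nonneg fun j _ => mul_nonneg (hw0 j) (hd j)
  have h3' : ∑ j, w j * d j ≤ hN.eigenvalues i := by
    simpa only [mul_comm (w _)] using h3
  have h2' : hM.eigenvalues i ≤ ∑ j, w j * f (d j) := by
    simpa only [mul_comm (w _)] using h2
  have hf00 := mul_nonneg (sub_nonneg.2 hw1) (hf0 0 (Set.mem_Ici.2 le_rfl))
  have hmono := hf.monotoneOn_Ici_of_nonneg hf0 hsum (hsum.trans h3') h3'
  linarith

theorem PosSemidef.exists_isHermitian_mul_self {S : Matrix n n ℂ} (hS : S.PosSemidef) :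
    ∃ X : Matrix n n ℂ, X.IsHermitian ∧ X * X = S := by
  open scoped MatrixOrder in
  exact ⟨CFC.sqrt S, (CFC.sqrt_nonneg S).posSemidef.1, CFC.sqrt_mul_sqrt_self S hS.nonneg⟩

theorem diagonal_sqrt_mul_self {d : n → ℝ} (hd : ∀ i, 0 ≤ d i) :
    diagonal (fun i => ((√(d i) : ℝ) : ℂ)) * diagonal (fun i => ((√(d i) : ℝ) : ℂ)) =
      diagonal (fun i => (d i : ℂ)) := by
  rw [diagonal_mul_diagonal]
  congr 1
  ext i
  rw [← Complex.ofReal_mul, Real.mul_self_sqrt (hd i)]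

theorem charpoly_diagonal_sqrt_conj {d : n → ℝ} (hd : ∀ i, 0 ≤ d i) (X : Matrix n n ℂ) :
    (diagonal (fun i => ((√(d i) : ℝ) : ℂ)) * (Xᴴ * X) *
      diagonal (fun i => ((√(d i) : ℝ) : ℂ))).charpoly =
      (X * diagonal (fun i => (d i : ℂ)) * Xᴴ).charpoly := by
  rw [← Matrix.mul_assoc, Matrix.mul_assoc, charpoly_mul_comm, ← diagonal_sqrt_mul_self hd]
  simp only [Matrix.mul_assoc]

/-- If `D ≥ 0` is diagonal and `0 ≤ S ≤ 1`, then `f(D)^{1/2} S f(D)^{1/2}` is dominated by a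
unitary conjugate of `f(A)` for every Hermitian `A` with the same spectrum as
`D^{1/2} S D^{1/2}`. -/
theorem exists_unitary_conj_le {n : ℕ} {f : ℝ → ℝ} (hf : ConcaveOn ℝ (Set.Ici 0) f)
    (hf0 : ∀ x ∈ Set.Ici (0 : ℝ), 0 ≤ f x) {d : Fin n → ℝ} (hd : ∀ i, 0 ≤ d i)
    {S : Matrix (Fin n) (Fin n) ℂ} (hS : S.PosSemidef) (hS1 : (1 - S).PosSemidef)
    {A : Matrix (Fin n) (Fin n) ℂ} (hA : A.IsHermitian)
    (hAS : A.charpoly = (diagonal (fun i => ((√(d i) : ℝ) : ℂ)) * S *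
      diagonal (fun i => ((√(d i) : ℝ) : ℂ))).charpoly) :
    ∃ U ∈ unitaryGroup (Fin n) ℂ,
      (U * matFn f A hA * Uᴴ - diagonal (fun i => ((√(f (d i)) : ℝ) : ℂ)) * S *
        diagonal (fun i => ((√(f (d i)) : ℝ) : ℂ))).PosSemidef := by
  obtain ⟨X, hX, rfl⟩ := hS.exists_isHermitian_mul_self
  have hM := isHermitian_mul_mul_conjTranspose X (isHermitian_diagonal_ofReal fun i => f (d i))
  have hN := isHermitian_mul_mul_conjTranspose X (isHermitian_diagonal_ofReal d)
  have hXX : Xᴴ * X = X * X := by rw [hX.eq]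
  have hG : (diagonal (fun i => ((√(f (d i)) : ℝ) : ℂ)) * (X * X) *
      diagonal (fun i => ((√(f (d i)) : ℝ) : ℂ))).IsHermitian := by
    have := isHermitian_mul_mul_conjTranspose (diagonal (fun i => ((√(f (d i)) : ℝ) : ℂ))) hS.1
    rwa [(isHermitian_diagonal_ofReal fun i => √(f (d i))).eq] at this
  have hGM : hG.eigenvalues = hM.eigenvalues := by
    rw [IsHermitian.eigenvalues_eq_eigenvalues_iff, ← hXX]
    exact charpoly_diagonal_sqrt_conj (fun i => hf0 _ (hd i)) X
  have hAN : hA.eigenvalues = hN.eigenvalues := by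
    rw [IsHermitian.eigenvalues_eq_eigenvalues_iff, hAS, ← hXX]
    exact charpoly_diagonal_sqrt_conj hd X
  have hle (i : Fin n) : hG.eigenvalues i ≤ f (hA.eigenvalues i) := by
    rw [hGM, hAN]
    exact eigenvalues_contraction_le hf hf0 hd (by rwa [hX.eq]) hM hN i
  have hZ : (hA.eigenvectorUnitary : Matrix (Fin n) (Fin n) ℂ)ᴴ *
      (hA.eigenvectorUnitary : Matrix (Fin n) (Fin n) ℂ) = 1 :=
    mem_unitaryGroup_iff'.1 hA.eigenvectorUnitary.2
  refine ⟨_, (hG.eigenvectorUnitary * star hA.eigenvectorUnitary).2, ?_⟩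
  have hconj : ((hG.eigenvectorUnitary * star hA.eigenvectorUnitary : unitaryGroup (Fin n) ℂ) :
      Matrix (Fin n) (Fin n) ℂ) * matFn f A hA *
      ((hG.eigenvectorUnitary * star hA.eigenvectorUnitary : unitaryGroup (Fin n) ℂ) :
        Matrix (Fin n) (Fin n) ℂ)ᴴ =
      (hG.eigenvectorUnitary : Matrix (Fin n) (Fin n) ℂ) *
        diagonal (fun i => (f (hA.eigenvalues i) : ℂ)) *
        (hG.eigenvectorUnitary : Matrix (Fin n) (Fin n) ℂ)ᴴ := by
    rw [matFn]
    push_cast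
    simp only [star_eq_conjTranspose, conjTranspose_mul, conjTranspose_conjTranspose]
    set Z : Matrix (Fin n) (Fin n) ℂ := hA.eigenvectorUnitary.1
    set Q : Matrix (Fin n) (Fin n) ℂ := hG.eigenvectorUnitary.1
    set F : Matrix (Fin n) (Fin n) ℂ := diagonal (fun i => (f (hA.eigenvalues i) : ℂ))
    calc Q * Zᴴ * (Z * F * Zᴴ) * (Z * Qᴴ) = Q * (Zᴴ * Z) * F * (Zᴴ * Z) * Qᴴ := by
          simp only [Matrix.mul_assoc]
      _ = Q * F * Qᴴ := by rw [hZ, Matrix.mul_one, Matrix.mul_one]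
  rw [hconj]
  suffices h : ((hG.eigenvectorUnitary : Matrix (Fin n) (Fin n) ℂ) *
      diagonal (fun i => (f (hA.eigenvalues i) : ℂ)) *
        (hG.eigenvectorUnitary : Matrix (Fin n) (Fin n) ℂ)ᴴ -
      (hG.eigenvectorUnitary : Matrix (Fin n) (Fin n) ℂ) *
      diagonal (fun i => (hG.eigenvalues i : ℂ)) *
        (hG.eigenvectorUnitary : Matrix (Fin n) (Fin n) ℂ)ᴴ).PosSemidef by
    rwa [← hG.eq_conj_diagonal] at h
  rw [← Matrix.sub_mul, ← Matrix.mul_sub, diagonal_sub]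
  refine PosSemidef.mul_mul_conjTranspose_same (PosSemidef.diagonal fun i => ?_) _
  rw [Pi.zero_apply, ← Complex.ofReal_sub, Complex.zero_le_real]
  exact sub_nonneg.2 (hle i)

/-- If `A + B` is diagonal, then `A` and `B` factor through its square root with weights summing
to the identity. -/
theorem exists_weights_of_add_eq_diagonal {A B : Matrix n n ℂ} (hA : A.PosSemidef)
    (hB : B.PosSemidef) {d : n → ℝ} (hd : ∀ i, 0 ≤ d i)
    (hAB : A + B = diagonal (fun i => (d i : ℂ))) :
    ∃ S R : Matrix n n ℂ, S.PosSemidef ∧ R.PosSemidef ∧ S + R = 1 ∧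
      diagonal (fun i => ((√(d i) : ℝ) : ℂ)) * S * diagonal (fun i => ((√(d i) : ℝ) : ℂ)) = A ∧
      diagonal (fun i => ((√(d i) : ℝ) : ℂ)) * R * diagonal (fun i => ((√(d i) : ℝ) : ℂ)) = B := by
  set E : Matrix n n ℂ := diagonal (fun i => (((√(d i))⁻¹ : ℝ) : ℂ)) with hE
  set P : Matrix n n ℂ := diagonal (fun i => ((if d i = 0 then 1 else 0 : ℝ) : ℂ)) with hP
  have hEh : Eᴴ = E := (isHermitian_diagonal_ofReal _).eq
  have hPp : P.PosSemidef := PosSemidef.diagonal fun i => by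
    rw [Pi.zero_apply, Complex.zero_le_real]
    split_ifs <;> simp
  have hzero {A B : Matrix n n ℂ} (hA : A.PosSemidef) (hB : B.PosSemidef)
      (hAB : A + B = diagonal (fun i => (d i : ℂ))) {i : n} (hi : d i = 0) (j : n) :
      A i j = 0 ∧ A j i = 0 := by
    have hii : A i i = 0 := by
      have h := congrFun (congrFun hAB i) i
      rw [add_apply, diagonal_apply_eq, hi, Complex.ofReal_zero] at h
      exact ((add_eq_zero_iff_of_nonneg hA.diag_nonneg hB.diag_nonneg).1 h).1
    have hcol : A *ᵥ Pi.single i 1 = 0 := by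
      rw [← hA.dotProduct_mulVec_zero_iff]
      simp [hii]
    have hji : A j i = 0 := by simpa using congrFun hcol j
    exact ⟨by rw [← hA.1.apply, hji, star_zero], hji⟩
  have hfac {A B : Matrix n n ℂ} (hA : A.PosSemidef) (hB : B.PosSemidef)
      (hAB : A + B = diagonal (fun i => (d i : ℂ))) :
      diagonal (fun i => ((√(d i) : ℝ) : ℂ)) * (E * A * E) *
        diagonal (fun i => ((√(d i) : ℝ) : ℂ)) = A := by
    ext i j
    simp only [hE, mul_diagonal, diagonal_mul]
    by_cases hi : d i = 0
    · simp [(hzero hA hB hAB hi j).1]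
    by_cases hj : d j = 0
    · simp [(hzero hA hB hAB hj i).2]
    have hi' : ((√(d i) : ℝ) : ℂ) ≠ 0 := by
      exact_mod_cast (Real.sqrt_pos.2 (lt_of_le_of_ne (hd i) (Ne.symm hi))).ne'
    have hj' : ((√(d j) : ℝ) : ℂ) ≠ 0 := by
      exact_mod_cast (Real.sqrt_pos.2 (lt_of_le_of_ne (hd j) (Ne.symm hj))).ne'
    push_cast
    field_simp
  refine ⟨E * A * E + P, E * B * E, ?_, ?_, ?_, ?_, ?_⟩
  · exact .add (by simpa [hEh] using hA.mul_mul_conjTranspose_same E) hPp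
  · simpa [hEh] using hB.mul_mul_conjTranspose_same E
  · rw [add_right_comm, ← Matrix.add_mul, ← Matrix.mul_add, hAB, hE, hP, diagonal_mul_diagonal,
      diagonal_mul_diagonal, diagonal_add, ← diagonal_one]
    congr 1
    ext i
    by_cases hi : d i = 0
    · simp [hi]
    · have hi' : √(d i) ≠ 0 := (Real.sqrt_pos.2 (lt_of_le_of_ne (hd i) (Ne.symm hi))).ne'
      rw [if_neg hi]
      norm_cast
      rw [add_zero, mul_right_comm, ← mul_inv, Real.mul_self_sqrt (hd i), inv_mul_cancel₀ hi]
  · rw [Matrix.mul_add, Matrix.add_mul, hfac hA hB hAB, hP, diagonal_mul_diagonal,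
      diagonal_mul_diagonal, add_eq_left, ← diagonal_zero]
    congr 1
    ext i
    by_cases hi : d i = 0 <;> simp [hi]
  · exact hfac hB hA (by rw [add_comm, hAB])

end Matrix

/-- Subadditivity up to unitaries: for positive semidefinite `A`, `B` and a non-negative
concave function `f` on `[0,∞)`, there are unitaries `U`, `V` with
`f(A+B) ≤ U f(A) U* + V f(B) V*` in the Loewner order. -/
theorem concave_subadditive_unitary {n : ℕ} (A B : Matrix (Fin n) (Fin n) ℂ)
    (hA : A.PosSemidef) (hB : B.PosSemidef)
    (f : ℝ → ℝ) (hf : ConcaveOn ℝ (Set.Ici 0) f)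
    (hf0 : ∀ x ∈ Set.Ici (0 : ℝ), 0 ≤ f x) :
    ∃ U ∈ Matrix.unitaryGroup (Fin n) ℂ, ∃ V ∈ Matrix.unitaryGroup (Fin n) ℂ,
      (U * matFn f A hA.1 * Uᴴ + V * matFn f B hB.1 * Vᴴ -
        matFn f _ (hA.1.add hB.1)).PosSemidef := by
  have hC : (A + B).PosSemidef := hA.add hB
  set d := hC.1.eigenvalues with hddef
  have hd : ∀ i, 0 ≤ d i := hC.eigenvalues_nonneg
  set W : Matrix (Fin n) (Fin n) ℂ := hC.1.eigenvectorUnitary.1 with hWdef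
  have hW : W ∈ unitaryGroup (Fin n) ℂ := hC.1.eigenvectorUnitary.2
  have hWW : W * Wᴴ = 1 := mem_unitaryGroup_iff.1 hW
  have hWW' : Wᴴ * W = 1 := mem_unitaryGroup_iff'.1 hW
  have hsum : Wᴴ * A * W + Wᴴ * B * W = diagonal (fun i => (d i : ℂ)) := by
    have hspec : A + B = W * diagonal (fun i => (d i : ℂ)) * Wᴴ := hC.1.eq_conj_diagonal
    rw [← Matrix.add_mul, ← Matrix.mul_add, hspec, Matrix.mul_assoc, Matrix.mul_assoc, hWW',
      Matrix.mul_one, ← Matrix.mul_assoc, hWW', Matrix.one_mul]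
  have hchar (Q : Matrix (Fin n) (Fin n) ℂ) : Q.charpoly = (Wᴴ * Q * W).charpoly := by
    rw [charpoly_mul_comm, ← Matrix.mul_assoc, hWW, Matrix.one_mul]
  obtain ⟨S, R, hS, hR, hSR, hSA, hRB⟩ := exists_weights_of_add_eq_diagonal
    (hA.conjTranspose_mul_mul_same W) (hB.conjTranspose_mul_mul_same W) hd hsum
  obtain ⟨U, hU, hUle⟩ := exists_unitary_conj_le hf hf0 hd hS
    (by rwa [← hSR, add_sub_cancel_left]) hA.1 (by rw [hSA, ← hchar])
  obtain ⟨V, hV, hVle⟩ := exists_unitary_conj_le hf hf0 hd hR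
    (by rwa [← hSR, add_sub_cancel_right]) hB.1 (by rw [hRB, ← hchar])
  refine ⟨W * U, mul_mem hW hU, W * V, mul_mem hW hV, ?_⟩
  have hFn : matFn f (A + B) hC.1 = W * diagonal (fun i => (f (d i) : ℂ)) * Wᴴ := rfl
  have hF : diagonal (fun i => (f (d i) : ℂ)) =
      diagonal (fun i => ((√(f (d i)) : ℝ) : ℂ)) * S * diagonal (fun i => ((√(f (d i)) : ℝ) : ℂ)) +
      diagonal (fun i => ((√(f (d i)) : ℝ) : ℂ)) * R *
        diagonal (fun i => ((√(f (d i)) : ℝ) : ℂ)) := by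
    rw [← Matrix.add_mul, ← Matrix.mul_add, hSR, Matrix.mul_one,
      diagonal_sqrt_mul_self fun i => hf0 _ (hd i)]
  convert (hUle.add hVle).mul_mul_conjTranspose_same W using 1
  rw [hFn, hF]
  simp only [conjTranspose_mul, Matrix.mul_add, Matrix.add_mul, Matrix.mul_sub, Matrix.sub_mul,
    Matrix.mul_assoc]
  abel
end

section
/- (McCarthy's inequality) Let A and B be positive semidefinite n×n complex matrices and let p > 1 be a real number. Then Tr(Aᵖ + Bᵖ) ≤ Tr (A+B)ᵖ. -/
open Matrix ComplexOrder

/-- Jensen's inequality for `t ↦ t ^ p` with subprobability weights. -/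
theorem rpow_sum_mul_le_of_sum_le_one {ι : Type*} [Fintype ι] (w x : ι → ℝ)
    (hw : ∀ i, 0 ≤ w i) (hw1 : ∑ i, w i ≤ 1) (hx : ∀ i, 0 ≤ x i) {p : ℝ} (hp : 1 < p) :
    (∑ i, w i * x i) ^ p ≤ ∑ i, w i * x i ^ p := by
  have h := (convexOn_rpow hp.le).map_add_sum_le (t := Finset.univ) (w := w) (p := x)
    (v := 1 - ∑ i, w i) (q := 0) (fun i _ => hw i) (by ring) (fun i _ => hx i)
    (by linarith) (by simp)
  simpa [Real.zero_rpow (by linarith : p ≠ 0)] using h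

/-- If `W` has orthonormal rows and `Wᴴ * diagonal α * W ≤ diagonal γ` as quadratic forms, then
`Tr αᵖ ≤ Tr (Wᴴ * diagonal α * W * γᵖ⁻¹)`. -/
theorem sum_rpow_le_of_quadForm_le {ι κ : Type*} [Fintype ι] [DecidableEq ι] [Fintype κ]
    [DecidableEq κ] (W : Matrix ι κ ℂ) (hW : W * Wᴴ = 1) (α : ι → ℝ) (γ : κ → ℝ)
    (hα : ∀ i, 0 ≤ α i) (hγ : ∀ l, 0 ≤ γ l)
    (h : ∀ x : κ → ℂ, ∑ i, α i * ‖(W *ᵥ x) i‖ ^ 2 ≤ ∑ l, γ l * ‖x l‖ ^ 2)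
    {p : ℝ} (hp : 1 < p) :
    ∑ i, α i ^ p ≤ ∑ l, (∑ i, α i * ‖W i l‖ ^ 2) * γ l ^ (p - 1) := by
  have hrow (i : ι) : ∑ l, ‖W i l‖ ^ 2 = 1 := by
    have h1 := congrFun (congrFun hW i) i
    simp only [mul_apply, conjTranspose_apply, one_apply_eq, RCLike.star_def,
      Complex.mul_conj'] at h1
    exact_mod_cast h1
  have hzero (i : ι) (l : κ) (hl : γ l = 0) : α i * ‖W i l‖ ^ 2 = 0 := by
    have h1 := h (Pi.single l 1)
    have h2 : ∑ k, γ k * ‖(Pi.single l 1 : κ → ℂ) k‖ ^ 2 = 0 := by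
      refine Finset.sum_eq_zero fun k _ => ?_
      by_cases hk : k = l
      · simp [hk, hl]
      · simp [hk]
    have h3 : α i * ‖(W *ᵥ Pi.single l 1) i‖ ^ 2 ≤ ∑ i, α i * ‖(W *ᵥ Pi.single l 1) i‖ ^ 2 :=
      Finset.single_le_sum (f := fun i => α i * ‖(W *ᵥ Pi.single l 1) i‖ ^ 2)
        (fun i _ => mul_nonneg (hα i) (sq_nonneg _)) (Finset.mem_univ i)
    have h4 := h3.trans (h1.trans_eq h2)
    rw [mulVec_single_one, col_apply] at h4
    exact le_antisymm h4 (mul_nonneg (hα i) (sq_nonneg _))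
  have hterm (i : ι) : α i ^ p ≤ ∑ l, α i * ‖W i l‖ ^ 2 * γ l ^ (p - 1) := by
    have hsum : ∑ l, α i * ‖W i l‖ ^ 2 / γ l ≤ 1 := by
      have h1 := h fun l => star (W i l) / γ l
      have h2 := (Finset.single_le_sum
        (f := fun i' => α i' * ‖(W *ᵥ fun l => star (W i l) / γ l) i'‖ ^ 2)
        (fun i _ => mul_nonneg (hα i) (sq_nonneg _)) (Finset.mem_univ i)).trans h1
      set s : ℝ := ∑ l, ‖W i l‖ ^ 2 / γ l with hs
      have h3 : (W *ᵥ fun l => star (W i l) / γ l) i = (s : ℂ) := by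
        simp only [mulVec, dotProduct, hs, Complex.ofReal_sum]
        refine Finset.sum_congr rfl fun l _ => ?_
        rw [← mul_div_assoc, RCLike.star_def, RCLike.mul_conj]
        push_cast
        rfl
      have h4 : ∑ l, γ l * ‖star (W i l) / (γ l : ℂ)‖ ^ 2 = s := by
        refine Finset.sum_congr rfl fun l _ => ?_
        rw [norm_div, norm_star, Complex.norm_real, Real.norm_of_nonneg (hγ l)]
        rcases eq_or_ne (γ l) 0 with hl | hl
        · simp [hl]
        · field_simp
      rw [h4] at h2
      simp only [h3, Complex.norm_real, Real.norm_eq_abs, sq_abs] at h2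
      have h5 : ∑ l, α i * ‖W i l‖ ^ 2 / γ l = α i * s := by
        simp only [hs, Finset.mul_sum, mul_div_assoc]
      rw [h5]
      have hs0 : 0 ≤ s := Finset.sum_nonneg fun l _ => div_nonneg (sq_nonneg _) (hγ l)
      rcases hs0.eq_or_lt with h0 | h0
      · simp [← h0]
      · exact le_of_mul_le_mul_right (by nlinarith) h0
    have hJ := rpow_sum_mul_le_of_sum_le_one (fun l => α i * ‖W i l‖ ^ 2 / γ l) γ
      (fun l => div_nonneg (mul_nonneg (hα i) (sq_nonneg _)) (hγ l)) hsum hγ hp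
    have e1 : ∑ l, α i * ‖W i l‖ ^ 2 / γ l * γ l = α i := by
      calc ∑ l, α i * ‖W i l‖ ^ 2 / γ l * γ l = ∑ l, α i * ‖W i l‖ ^ 2 :=
            Finset.sum_congr rfl fun l _ => div_mul_cancel_of_imp (hzero i l)
        _ = α i := by rw [← Finset.mul_sum, hrow, mul_one]
    rw [e1] at hJ
    refine hJ.trans_eq (Finset.sum_congr rfl fun l _ => ?_)
    rcases (hγ l).eq_or_lt with hl | hl
    · simp [hzero i l hl.symm]
    · rw [Real.rpow_sub_one hl.ne']
      ring
  calc ∑ i, α i ^ p ≤ ∑ i, ∑ l, α i * ‖W i l‖ ^ 2 * γ l ^ (p - 1) :=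
        Finset.sum_le_sum fun i _ => hterm i
    _ = _ := by
        rw [Finset.sum_comm]
        exact Finset.sum_congr rfl fun l _ => (Finset.sum_mul ..).symm

theorem dotProduct_conj_diagonal_mulVec {ι κ : Type*} [Fintype ι] [DecidableEq ι] [Fintype κ]
    (W : Matrix ι κ ℂ) (α : ι → ℝ) (x : κ → ℂ) :
    star x ⬝ᵥ ((Wᴴ * diagonal (fun i => (α i : ℂ)) * W) *ᵥ x) =
      ((∑ i, α i * ‖(W *ᵥ x) i‖ ^ 2 : ℝ) : ℂ) := by
  rw [← mulVec_mulVec, ← mulVec_mulVec, dotProduct_mulVec, ← star_mulVec]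
  simp only [dotProduct, mulVec_diagonal, Pi.star_apply, Complex.ofReal_sum]
  refine Finset.sum_congr rfl fun i _ => ?_
  rw [mul_left_comm, RCLike.star_def, RCLike.conj_mul]
  push_cast
  rfl

theorem conjTranspose_mul_mul_eq_conj_diagonal {n : ℕ} (A V : Matrix (Fin n) (Fin n) ℂ)
    (hA : A.IsHermitian) :
    Vᴴ * A * V = ((hA.eigenvectorUnitary : Matrix (Fin n) (Fin n) ℂ)ᴴ * V)ᴴ *
      diagonal (fun i => (hA.eigenvalues i : ℂ)) *
      ((hA.eigenvectorUnitary : Matrix (Fin n) (Fin n) ℂ)ᴴ * V) := by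
  conv_lhs => rw [hA.spectral_theorem, Unitary.conjStarAlgAut_apply]
  simp only [conjTranspose_mul, conjTranspose_conjTranspose, Matrix.mul_assoc,
    star_eq_conjTranspose]
  rfl

/-- McCarthy's inequality: for positive semidefinite `A`, `B` and a real `p > 1`,
`Tr (A^p + B^p) ≤ Tr (A+B)^p`. -/
theorem mccarthy_trace {n : ℕ} (A B : Matrix (Fin n) (Fin n) ℂ)
    (hA : A.PosSemidef) (hB : B.PosSemidef) (p : ℝ) (hp : 1 < p) :
    (matFn (fun x => x ^ p) A hA.1 + matFn (fun x => x ^ p) B hB.1).trace ≤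
    (matFn (fun x => x ^ p) _ (hA.1.add hB.1)).trace := by
  obtain ⟨V, hV⟩ : ∃ V : Matrix (Fin n) (Fin n) ℂ, V = (hA.1.add hB.1).eigenvectorUnitary :=
    ⟨_, rfl⟩
  set γ := (hA.1.add hB.1).eigenvalues with hγ
  set WA := (hA.1.eigenvectorUnitary : Matrix (Fin n) (Fin n) ℂ)ᴴ * V
  set WB := (hB.1.eigenvectorUnitary : Matrix (Fin n) (Fin n) ℂ)ᴴ * V
  have hVV : V * Vᴴ = 1 := hV ▸ Unitary.coe_mul_star_self (hA.1.add hB.1).eigenvectorUnitary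
  have hVV' : Vᴴ * V = 1 := hV ▸ Unitary.coe_star_mul_self (hA.1.add hB.1).eigenvectorUnitary
  have hrows (U : unitaryGroup (Fin n) ℂ) :
      ((U : Matrix (Fin n) (Fin n) ℂ)ᴴ * V) * ((U : Matrix (Fin n) (Fin n) ℂ)ᴴ * V)ᴴ = 1 := by
    rw [conjTranspose_mul, conjTranspose_conjTranspose, Matrix.mul_assoc, ← Matrix.mul_assoc V,
      hVV, Matrix.one_mul]
    exact Unitary.coe_star_mul_self U
  have hdecomp : WAᴴ * diagonal (fun i => (hA.1.eigenvalues i : ℂ)) * WA +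
      WBᴴ * diagonal (fun i => (hB.1.eigenvalues i : ℂ)) * WB =
      1ᴴ * diagonal (fun i => (γ i : ℂ)) * 1 := by
    rw [← conjTranspose_mul_mul_eq_conj_diagonal, ← conjTranspose_mul_mul_eq_conj_diagonal,
      ← Matrix.add_mul, ← Matrix.mul_add,
      conjTranspose_mul_mul_eq_conj_diagonal (A + B) V (hA.1.add hB.1), ← hV, hVV']
  have hquad (x : Fin n → ℂ) : ∑ i, hA.1.eigenvalues i * ‖(WA *ᵥ x) i‖ ^ 2 +
      ∑ i, hB.1.eigenvalues i * ‖(WB *ᵥ x) i‖ ^ 2 = ∑ l, γ l * ‖x l‖ ^ 2 := by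
    have h := congrArg (fun M => star x ⬝ᵥ (M *ᵥ x)) hdecomp
    simp only [add_mulVec, dotProduct_add, dotProduct_conj_diagonal_mulVec, one_mulVec] at h
    exact_mod_cast h
  have hα := hA.eigenvalues_nonneg
  have hβ := hB.eigenvalues_nonneg
  have hγ0 : ∀ l, 0 ≤ γ l := (hA.add hB).eigenvalues_nonneg
  have hdiag (l : Fin n) : ∑ i, hA.1.eigenvalues i * ‖WA i l‖ ^ 2 +
      ∑ i, hB.1.eigenvalues i * ‖WB i l‖ ^ 2 = γ l := by
    have h := hquad (Pi.single l 1)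
    have hl : ∑ k, γ k * ‖(Pi.single l 1 : Fin n → ℂ) k‖ ^ 2 = γ l := by
      rw [Finset.sum_eq_single l (fun k _ hk => by simp [hk]) (by simp)]
      simp
    rw [mulVec_single_one, mulVec_single_one, hl] at h
    exact h
  have hAle := sum_rpow_le_of_quadForm_le WA (hrows _) _ γ hα hγ0 (fun x => by
    rw [← hquad x]
    exact le_add_of_nonneg_right
      (Finset.sum_nonneg fun i _ => mul_nonneg (hβ i) (sq_nonneg _))) hp
  have hBle := sum_rpow_le_of_quadForm_le WB (hrows _) _ γ hβ hγ0 (fun x => by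
    rw [← hquad x]
    exact le_add_of_nonneg_left
      (Finset.sum_nonneg fun i _ => mul_nonneg (hα i) (sq_nonneg _))) hp
  rw [trace_add, trace_matFn, trace_matFn, trace_matFn, ← Complex.ofReal_add,
    Complex.real_le_real]
  refine (add_le_add hAle hBle).trans_eq ?_
  rw [← Finset.sum_add_distrib]
  refine Finset.sum_congr rfl fun l _ => ?_
  rw [← add_mul, hdiag]
  rcases (hγ0 l).eq_or_lt with hl | hl
  · simp [← hγ, ← hl, Real.zero_rpow (by linarith : p ≠ 0)]
  · rw [Real.rpow_sub_one hl.ne', mul_div_cancel₀ _ hl.ne']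
end
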